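/- arXiv:1712.05481 — 2 statements merged into one kernel-verified Lean document; each statement's English description precedes it below -/
import Mathlib

section
/- Let f ∈ R[x_1,…,x_n], let p_u, p_v be positive integers and u, v ∈ ℕ^n. If #(f^mod_(p_u)(x^u)) ≥ #(f^mod_(p_v)(x^v)), then C_f(p_u, u) ≤ 2·C_f(p_v, v). -/
open scoped Classical

noncomputable section

/-- Dot product of a substitution vector `s` with an exponent vector `e`. -/
def dotProd {n : ℕ} (s : Fin n → ℕ) (e : Fin n →₀ ℕ) : ℕ := ∑ i, s i * e i

/-- The univariate polynomial `f(x^s)` obtained by the Kronecker substitution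
`x_i = x^(s i)`. -/
def kron {R : Type*} [CommRing R] {n : ℕ} (s : Fin n → ℕ)
    (f : MvPolynomial (Fin n) R) : Polynomial R :=
  MvPolynomial.eval₂ Polynomial.C (fun i => Polynomial.X ^ s i) f

/-- `f^mod_(p)(x^s) := f(x^s) mod (x^p - 1)`. -/
def kronMod {R : Type*} [CommRing R] {n : ℕ} (p : ℕ) (s : Fin n → ℕ)
    (f : MvPolynomial (Fin n) R) : Polynomial R :=
  kron s f %ₘ (Polynomial.X ^ p - 1)

/-- The term of `f` with exponent vector `e` collides in `f^mod_(p)(x^s)`: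
`f` has another term with exponent vector `e' ≠ e` such that
`s·e ≡ s·e' (mod p)`. -/
def Collides {R : Type*} [CommRing R] {n : ℕ} (f : MvPolynomial (Fin n) R)
    (p : ℕ) (s : Fin n → ℕ) (e : Fin n →₀ ℕ) : Prop :=
  ∃ e' ∈ f.support, e' ≠ e ∧ dotProd s e ≡ dotProd s e' [MOD p]

/-- `C_f(p,s)`: the number of terms of `f` that collide in `f^mod_(p)(x^s)`. -/
def numCollide {R : Type*} [CommRing R] {n : ℕ} (f : MvPolynomial (Fin n) R)
    (p : ℕ) (s : Fin n → ℕ) : ℕ :=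
  (f.support.filter (fun e => Collides f p s e)).card

/-- The substitution vector `s + p·I_k`. -/
def sShift {n : ℕ} (s : Fin n → ℕ) (p : ℕ) (k : Fin n) : Fin n → ℕ :=
  fun j => if j = k then s j + p else s j

/-- Reduction of a monomial modulo `X ^ p - 1` reduces its exponent modulo `p`. -/
theorem monomial_modByMonic_X_pow_sub_one {R : Type*} [CommRing R] [Nontrivial R] {p : ℕ}
    (hp : 0 < p) (k : ℕ) (a : R) :
    Polynomial.monomial k a %ₘ (Polynomial.X ^ p - 1 : Polynomial R) =
      Polynomial.monomial (k % p) a := by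
  have hdeg : (Polynomial.X ^ p - 1 : Polynomial R).degree = p := by
    simpa using Polynomial.degree_X_pow_sub_C (R := R) hp 1
  have hmonic : (Polynomial.X ^ p - 1 : Polynomial R).Monic := by
    simpa using Polynomial.monic_X_pow_sub_C (R := R) 1 hp.ne'
  have hself : Polynomial.monomial (k % p) a %ₘ (Polynomial.X ^ p - 1 : Polynomial R) =
      Polynomial.monomial (k % p) a := by
    rw [Polynomial.modByMonic_eq_self_iff hmonic, hdeg]
    exact (Polynomial.degree_monomial_le _ _).trans_lt (by exact_mod_cast Nat.mod_lt k hp)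
  rw [← hself]
  apply Polynomial.modByMonic_eq_of_dvd_sub hmonic
  have hfactor : (Polynomial.monomial k a - Polynomial.monomial (k % p) a : Polynomial R) =
      ((Polynomial.X ^ p) ^ (k / p) - 1) * Polynomial.monomial (k % p) a := by
    rw [sub_mul, one_mul, ← pow_mul, Polynomial.X_pow_mul, Polynomial.monomial_mul_X_pow,
      Nat.mod_add_div]
  rw [hfactor]
  exact (sub_one_dvd_pow_sub_one _ _).mul_right _

theorem kron_eq_sum {R : Type*} [CommRing R] {n : ℕ} (s : Fin n → ℕ)
    (f : MvPolynomial (Fin n) R) :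
    kron s f = ∑ e ∈ f.support, Polynomial.monomial (dotProd s e) (f.coeff e) := by
  rw [kron, MvPolynomial.eval₂_eq']
  refine Finset.sum_congr rfl fun e _ => ?_
  simp only [← pow_mul, Finset.prod_pow_eq_pow_sum, Polynomial.C_mul_X_pow_eq_monomial, dotProd]

theorem kronMod_eq_sum {R : Type*} [CommRing R] [Nontrivial R] {n p : ℕ} (hp : 0 < p)
    (s : Fin n → ℕ) (f : MvPolynomial (Fin n) R) :
    kronMod p s f = ∑ e ∈ f.support, Polynomial.monomial (dotProd s e % p) (f.coeff e) := by
  change Polynomial.modByMonicHom (Polynomial.X ^ p - 1) (kron s f) = _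
  rw [kron_eq_sum, map_sum]
  exact Finset.sum_congr rfl fun e _ => monomial_modByMonic_X_pow_sub_one hp _ _

theorem coeff_kronMod {R : Type*} [CommRing R] [Nontrivial R] {n p : ℕ} (hp : 0 < p)
    (s : Fin n → ℕ) (f : MvPolynomial (Fin n) R) (j : ℕ) :
    (kronMod p s f).coeff j =
      ∑ e ∈ f.support, if dotProd s e % p = j then f.coeff e else 0 := by
  rw [kronMod_eq_sum hp, Polynomial.finsetSum_coeff]
  simp only [Polynomial.coeff_monomial]

theorem support_kronMod_subset {R : Type*} [CommRing R] [Nontrivial R] {n p : ℕ} (hp : 0 < p)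
    (s : Fin n → ℕ) (f : MvPolynomial (Fin n) R) :
    (kronMod p s f).support ⊆ f.support.image (fun e => dotProd s e % p) := by
  intro j hj
  rw [Polynomial.mem_support_iff, coeff_kronMod hp] at hj
  obtain ⟨e, he, hne⟩ := Finset.exists_ne_zero_of_sum_ne_zero hj
  exact Finset.mem_image.2 ⟨e, he, by_contra fun hej => hne (if_neg hej)⟩

/-- The terms that do not collide survive as distinct terms of `f^mod_(p)(x^s)`. -/
theorem card_support_le_card_support_kronMod_add {R : Type*} [CommRing R] [Nontrivial R]
    {n p : ℕ} (hp : 0 < p) (s : Fin n → ℕ) (f : MvPolynomial (Fin n) R) :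
    f.support.card ≤ (kronMod p s f).support.card + numCollide f p s := by
  rw [← Finset.card_filter_add_card_filter_not (s := f.support) (fun e => Collides f p s e),
    add_comm]
  refine Nat.add_le_add_right (Finset.card_le_card_of_injOn (fun e => dotProd s e % p) ?_ ?_) _
  · intro e he
    obtain ⟨hef, hec⟩ := Finset.mem_filter.1 he
    have hcoeff : (kronMod p s f).coeff (dotProd s e % p) = f.coeff e := by
      rw [coeff_kronMod hp, Finset.sum_eq_single_of_mem e hef, if_pos rfl]
      exact fun e' he' hne => if_neg fun heq => hec ⟨e', he', hne, heq.symm⟩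
    rw [Finset.mem_coe, Polynomial.mem_support_iff, hcoeff]
    exact MvPolynomial.mem_support_iff.1 hef
  · intro e he e' he' heq
    by_contra hne
    exact (Finset.mem_filter.1 he).2 ⟨e', (Finset.mem_filter.1 he').1, Ne.symm hne, heq⟩

/-- At least two colliding terms share each exponent at which a collision happens. -/
theorem two_mul_card_image_collides_le {R : Type*} [CommRing R] {n : ℕ} (p : ℕ)
    (s : Fin n → ℕ) (f : MvPolynomial (Fin n) R) :
    2 * ((f.support.filter (fun e => Collides f p s e)).image
      (fun e => dotProd s e % p)).card ≤ numCollide f p s := by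
  refine Finset.mul_card_image_le_card _ 2 ?_
  intro j hj
  obtain ⟨e, he, rfl⟩ := Finset.mem_image.1 hj
  obtain ⟨hef, e', hef', hne, heq⟩ := Finset.mem_filter.1 he
  refine Finset.one_lt_card.2 ⟨e, Finset.mem_filter.2 ⟨he, rfl⟩, e', ?_, hne.symm⟩
  exact Finset.mem_filter.2 ⟨Finset.mem_filter.2 ⟨hef', e, hef, hne.symm, heq.symm⟩, heq.symm⟩

theorem two_mul_card_support_kronMod_add_le {R : Type*} [CommRing R] [Nontrivial R]
    {n p : ℕ} (hp : 0 < p) (s : Fin n → ℕ) (f : MvPolynomial (Fin n) R) :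
    2 * (kronMod p s f).support.card + numCollide f p s ≤ 2 * f.support.card := by
  have hcard := Finset.card_le_card (support_kronMod_subset hp s f)
  rw [← Finset.filter_union_filter_not_eq (fun e => Collides f p s e) f.support,
    Finset.image_union] at hcard
  have hunion := hcard.trans (Finset.card_union_le _ _)
  have hcollide := two_mul_card_image_collides_le p s f
  have hrest := Finset.card_image_le (s := f.support.filter (fun e => ¬ Collides f p s e))
    (f := fun e => dotProd s e % p)
  have hsplit :=
    Finset.card_filter_add_card_filter_not (s := f.support) (fun e => Collides f p s e)
  rw [numCollide] at *
  lia

theorem num_collide_le_of_more_terms {R : Type*} [CommRing R] {n : ℕ}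
    (f : MvPolynomial (Fin n) R)
    (pu pv : ℕ) (hpu : 0 < pu) (hpv : 0 < pv)
    (u v : Fin n → ℕ)
    (h : (kronMod pv v f).support.card ≤ (kronMod pu u f).support.card) :
    numCollide f pu u ≤ 2 * numCollide f pv v := by
  cases subsingleton_or_nontrivial R
  · simp [numCollide, Subsingleton.elim f 0]
  have hupper := two_mul_card_support_kronMod_add_le hpu u f
  have hlower := card_support_le_card_support_kronMod_add hpv v f
  lia

end
end

section
/- Let f ∈ R[x_1,…,x_n] be nonzero, T ≥ #f, D ≥ deg f, N = max{31·⌈(T−1)·log₂ D⌉, 1}, and let p_1,…,p_N be N distinct primes with p_i ≥ 32(T−1). Let μ ∈ (0,1) and l ≥ ⌈32·ln(T·μ^{−1})⌉. For i = 1,…,l, independently choose a prime p_{α_i} uniformly at random from {p_1,…,p_N} and then choose s_i uniformly at random from Z_{p_{α_i}}^n. Then with probability at least 1 − μ, every term of f collides in at most (3/16)·l of the l reduced polynomials f^mod_(p_{α_i})(x^{s_i}), i = 1,…,l. -/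
open scoped Classical

noncomputable section

/-- A Chernoff-type bound: the number of successes in `l` independent trials, each of which
succeeds with probability at most `1/16`, exceeds `(3/16) l` with probability at most
`exp (-l/32)`. -/
lemma sum_prod_filter_lt_card_le {A : Type*} [Fintype A] (w : A → ℝ) (hw : ∀ a, 0 ≤ w a)
    (hw1 : ∑ a, w a = 1) (C : A → Prop)
    (hC : ∑ a ∈ Finset.univ.filter C, w a ≤ 1 / 16) (l : ℕ) :
    ∑ ω ∈ Finset.univ.filter (fun ω : Fin l → A =>
        (3 / 16 : ℝ) * l < ((Finset.univ.filter (fun j => C (ω j))).card : ℝ)),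
      ∏ j, w (ω j) ≤ Real.exp (-(l : ℝ) / 32) := by
  have hone : ∑ a, w a * Real.exp (if C a then 1 else 0) ≤ Real.exp ((Real.exp 1 - 1) / 16) := by
    have hsplit : ∑ a, w a * Real.exp (if C a then 1 else 0) =
        ∑ a, w a + (Real.exp 1 - 1) * ∑ a ∈ Finset.univ.filter C, w a := by
      rw [Finset.sum_filter, Finset.mul_sum, ← Finset.sum_add_distrib]
      refine Finset.sum_congr rfl fun a _ => ?_
      split_ifs
      · ring
      · simp
    rw [hsplit, hw1]
    have hexp : (0 : ℝ) ≤ Real.exp 1 - 1 := by linarith [Real.add_one_le_exp (1 : ℝ)]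
    have := mul_le_mul_of_nonneg_left hC hexp
    have := Real.add_one_le_exp ((Real.exp 1 - 1) / 16)
    linarith
  calc _ ≤ ∑ ω : Fin l → A, Real.exp (-(3 / 16 * l)) *
          ∏ j, (w (ω j) * Real.exp (if C (ω j) then 1 else 0)) := by
        rw [Finset.sum_filter]
        refine Finset.sum_le_sum fun ω _ => ?_
        have hcard : ∑ j, (if C (ω j) then (1 : ℝ) else 0) =
            ((Finset.univ.filter (fun j => C (ω j))).card : ℝ) := by simp
        rw [Finset.prod_mul_distrib, ← Real.exp_sum, hcard, mul_left_comm, ← Real.exp_add]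
        have hprod : 0 ≤ ∏ j, w (ω j) := Finset.prod_nonneg fun j _ => hw _
        split_ifs with h
        · exact le_mul_of_one_le_right hprod (Real.one_le_exp (by linarith))
        · exact mul_nonneg hprod (Real.exp_nonneg _)
    _ = Real.exp (-(3 / 16 * l)) * (∑ a, w a * Real.exp (if C a then 1 else 0)) ^ l := by
        rw [Fintype.sum_pow, Finset.mul_sum]
    _ ≤ Real.exp (-(3 / 16 * l)) * Real.exp ((Real.exp 1 - 1) / 16) ^ l := by
        gcongr
        exact Finset.sum_nonneg fun a _ => mul_nonneg (hw a) (Real.exp_nonneg _)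
    _ ≤ Real.exp (-(l : ℝ) / 32) := by
        rw [← Real.exp_nat_mul, ← Real.exp_add, Real.exp_le_exp]
        have := Real.exp_one_lt_d9
        have hl : (0 : ℝ) ≤ l := Nat.cast_nonneg l
        nlinarith

/-- A union bound over `sum_prod_filter_lt_card_le`. -/
lemma one_sub_le_sum_prod_filter {A ι : Type*} [Fintype A] (w : A → ℝ) (hw : ∀ a, 0 ≤ w a)
    (hw1 : ∑ a, w a = 1) (S : Finset ι) (C : A → ι → Prop)
    (hC : ∀ e ∈ S, ∑ a ∈ Finset.univ.filter (C · e), w a ≤ 1 / 16) (l : ℕ) :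
    1 - S.card * Real.exp (-(l : ℝ) / 32) ≤
      ∑ ω ∈ Finset.univ.filter (fun ω : Fin l → A => ∀ e ∈ S,
        ((Finset.univ.filter (fun j => C (ω j) e)).card : ℝ) ≤ (3 / 16 : ℝ) * l),
      ∏ j, w (ω j) := by
  have htotal : ∑ ω : Fin l → A, ∏ j, w (ω j) = 1 := by
    rw [← Fintype.sum_pow, hw1, one_pow]
  have hprod : ∀ ω : Fin l → A, 0 ≤ ∏ j, w (ω j) := fun ω => Finset.prod_nonneg fun j _ => hw _
  rw [← Finset.sum_filter_add_sum_filter_not Finset.univ (fun ω : Fin l → A => ∀ e ∈ S,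
    ((Finset.univ.filter (fun j => C (ω j) e)).card : ℝ) ≤ (3 / 16 : ℝ) * l)] at htotal
  have hbad : ∑ ω ∈ Finset.univ.filter (fun ω : Fin l → A => ¬ ∀ e ∈ S,
      ((Finset.univ.filter (fun j => C (ω j) e)).card : ℝ) ≤ (3 / 16 : ℝ) * l),
      ∏ j, w (ω j) ≤ S.card * Real.exp (-(l : ℝ) / 32) := by
    calc _ ≤ ∑ e ∈ S, ∑ ω ∈ Finset.univ.filter (fun ω : Fin l → A =>
              (3 / 16 : ℝ) * l < ((Finset.univ.filter (fun j => C (ω j) e)).card : ℝ)),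
              ∏ j, w (ω j) := by
          simp only [Finset.sum_filter]
          rw [Finset.sum_comm]
          refine Finset.sum_le_sum fun ω _ => ?_
          have hnonneg : ∀ e ∈ S, 0 ≤ if (3 / 16 : ℝ) * l <
              ((Finset.univ.filter (fun j => C (ω j) e)).card : ℝ) then ∏ j, w (ω j) else 0 :=
            fun e _ => by split_ifs <;> simp [hprod ω]
          split_ifs with h
          · exact Finset.sum_nonneg hnonneg
          · push Not at h
            obtain ⟨e, he, h⟩ := h
            exact (if_pos h).ge.trans (Finset.single_le_sum hnonneg he)
      _ ≤ ∑ _e ∈ S, Real.exp (-(l : ℝ) / 32) := Finset.sum_le_sum fun e he =>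
          sum_prod_filter_lt_card_le w hw hw1 (C · e) (hC e he) l
      _ = _ := by simp
  linarith

/-- The solutions of a linear congruence that is nontrivial modulo the prime `q` form at most
a `1/q` fraction of all vectors. -/
lemma card_dotProd_modEq_mul_le {n q : ℕ} (hq : q.Prime) (e e' : Fin n →₀ ℕ) (k : Fin n)
    (hk : ¬ e k ≡ e' k [MOD q]) :
    (Finset.univ.filter (fun v : Fin n → Fin q =>
      dotProd (fun i => (v i : ℕ)) e ≡ dotProd (fun i => (v i : ℕ)) e' [MOD q])).card * q ≤
      q ^ n := by
  suffices h : ((Finset.univ.filter (fun v : Fin n → Fin q =>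
      dotProd (fun i => (v i : ℕ)) e ≡ dotProd (fun i => (v i : ℕ)) e' [MOD q])) ×ˢ
      (Finset.univ : Finset (Fin q))).card ≤ (Finset.univ : Finset (Fin n → Fin q)).card by
    simpa using h
  refine Finset.card_le_card_of_injOn (fun x => Function.update x.1 k x.2)
    (fun _ _ => Finset.mem_coe.2 (Finset.mem_univ _)) ?_
  rintro ⟨v, a⟩ hv ⟨v', a'⟩ hv' h
  simp only [Finset.coe_product, Set.mem_prod, Finset.mem_coe, Finset.mem_filter,
    Finset.mem_univ, true_and, and_true] at hv hv'
  simp only at h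
  have ha : a = a' := by simpa using congrFun h k
  have hoff : ∀ i, i ≠ k → v i = v' i := fun i hi => by
    simpa [Function.update_of_ne hi] using congrFun h i
  have : Fact q.Prime := ⟨hq⟩
  have key : ∀ u : Fin n → Fin q,
      dotProd (fun i => (u i : ℕ)) e ≡ dotProd (fun i => (u i : ℕ)) e' [MOD q] →
      ((u k : ℕ) : ZMod q) * ((e k : ZMod q) - e' k) +
        ∑ i ∈ Finset.univ.erase k, ((u i : ℕ) : ZMod q) * ((e i : ZMod q) - e' i) = 0 := by
    intro u hu
    rw [Finset.add_sum_erase _ (fun i => ((u i : ℕ) : ZMod q) * ((e i : ZMod q) - e' i))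
      (Finset.mem_univ k)]
    have := (ZMod.natCast_eq_natCast_iff _ _ _).2 hu
    simp only [dotProd, Nat.cast_sum, Nat.cast_mul] at this
    simp only [mul_sub, Finset.sum_sub_distrib, this, sub_self]
  have hne : (e k : ZMod q) - e' k ≠ 0 := by
    rw [sub_ne_zero]
    exact fun h' => hk ((ZMod.natCast_eq_natCast_iff _ _ _).1 h')
  have hsum : ∑ i ∈ Finset.univ.erase k, ((v i : ℕ) : ZMod q) * ((e i : ZMod q) - e' i) =
      ∑ i ∈ Finset.univ.erase k, ((v' i : ℕ) : ZMod q) * ((e i : ZMod q) - e' i) :=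
    Finset.sum_congr rfl fun i hi => by rw [hoff i (Finset.ne_of_mem_erase hi)]
  have h1 := key v hv
  rw [hsum, ← key v' hv', add_left_inj] at h1
  have h2 := (ZMod.natCast_eq_natCast_iff _ _ _).1 (mul_right_cancel₀ hne h1)
  have hvk : v k = v' k := Fin.ext (Nat.ModEq.eq_of_lt_of_lt h2 (v k).2 (v' k).2)
  refine Prod.ext (funext fun i => ?_) ha
  by_cases hi : i = k
  · rw [hi]; exact hvk
  · exact hoff i hi

/-- At most `log₂ D` distinct primes divide a positive integer `m ≤ D`. -/
lemma card_filter_prime_dvd_le_logb {ι : Type*} [Fintype ι] (p : ι → ℕ)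
    (hprime : ∀ i, (p i).Prime) (hdist : Function.Injective p) {m D : ℕ} (hm : m ≠ 0)
    (hmD : m ≤ D) :
    ((Finset.univ.filter (fun i => p i ∣ m)).card : ℝ) ≤ Real.logb 2 D := by
  have hdvd : ∏ i ∈ Finset.univ.filter (fun i => p i ∣ m), p i ∣ m := by
    refine Finset.prod_dvd_of_isRelPrime (fun i _ j _ hij => ?_)
      fun i hi => (Finset.mem_filter.1 hi).2
    exact Nat.coprime_iff_isRelPrime.1
      ((Nat.coprime_primes (hprime i) (hprime j)).2 fun h => hij (hdist h))
  have hpow : 2 ^ (Finset.univ.filter (fun i => p i ∣ m)).card ≤ D :=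
    (Finset.pow_card_le_prod _ _ _ fun i _ => (hprime i).two_le).trans
      ((Nat.le_of_dvd (Nat.pos_of_ne_zero hm) hdvd).trans hmD)
  rw [Real.le_logb_iff_rpow_le one_lt_two
    (by exact_mod_cast (Nat.pos_of_ne_zero hm).trans_le hmD), Real.rpow_natCast]
  exact_mod_cast hpow

/-- At most `log₂ D` of the primes `p i` identify two distinct exponent vectors with entries
bounded by `D`. -/
lemma card_filter_forall_modEq_le_logb {ι : Type*} [Fintype ι] (p : ι → ℕ)
    (hprime : ∀ i, (p i).Prime) (hdist : Function.Injective p) {n D : ℕ} {e e' : Fin n →₀ ℕ}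
    (hne : e' ≠ e) (he : ∀ k, e k ≤ D) (he' : ∀ k, e' k ≤ D) :
    ((Finset.univ.filter (fun i => ∀ k, e k ≡ e' k [MOD p i])).card : ℝ) ≤ Real.logb 2 D := by
  obtain ⟨k, hk⟩ := DFunLike.ne_iff.1 hne
  have hm : ((e' k : ℤ) - e k).natAbs ≠ 0 := by omega
  have hmD : ((e' k : ℤ) - e k).natAbs ≤ D := by
    have := he k
    have := he' k
    omega
  refine le_trans ?_ (card_filter_prime_dvd_le_logb p hprime hdist hm hmD)
  refine Nat.cast_le.2 (Finset.card_le_card fun i hi => ?_)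
  simp only [Finset.mem_filter, Finset.mem_univ, true_and] at hi ⊢
  exact Int.natCast_dvd.1 (Nat.modEq_iff_dvd.1 (hi k))

/-- A term of `f` collides modulo a fixed prime `q ≥ 32 (T - 1)` with probability at most `1/32`
unless its exponent vector is congruent modulo `q` to that of another term. -/
lemma card_filter_collides_le {R : Type*} [CommRing R] {n : ℕ} (f : MvPolynomial (Fin n) R)
    {T q : ℕ} (hT : f.support.card ≤ T) (hq : q.Prime) (hbig : 32 * (T - 1) ≤ q)
    {e : Fin n →₀ ℕ} (he : e ∈ f.support)
    (hgood : ∀ e' ∈ f.support, e' ≠ e → ¬ ∀ k, e k ≡ e' k [MOD q]) :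
    ((Finset.univ.filter (fun v : Fin n → Fin q =>
      Collides f q (fun k => (v k : ℕ)) e)).card : ℝ) ≤ (q : ℝ) ^ n / 32 := by
  have hsub : Finset.univ.filter (fun v : Fin n → Fin q =>
      Collides f q (fun k => (v k : ℕ)) e) ⊆ (f.support.erase e).biUnion fun e' =>
        Finset.univ.filter (fun v : Fin n → Fin q =>
          dotProd (fun i => (v i : ℕ)) e ≡ dotProd (fun i => (v i : ℕ)) e' [MOD q]) := by
    intro v hv
    obtain ⟨e', he', hne, h⟩ := (Finset.mem_filter.1 hv).2
    exact Finset.mem_biUnion.2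
      ⟨e', Finset.mem_erase.2 ⟨hne, he'⟩, Finset.mem_filter.2 ⟨Finset.mem_univ _, h⟩⟩
  have hcount : (Finset.univ.filter (fun v : Fin n → Fin q =>
      Collides f q (fun k => (v k : ℕ)) e)).card * q ≤ (T - 1) * q ^ n := by
    calc _ ≤ (∑ e' ∈ f.support.erase e, (Finset.univ.filter (fun v : Fin n → Fin q =>
          dotProd (fun i => (v i : ℕ)) e ≡ dotProd (fun i => (v i : ℕ)) e' [MOD q])).card) * q :=
          Nat.mul_le_mul_right _ ((Finset.card_le_card hsub).trans Finset.card_biUnion_le)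
      _ ≤ ∑ _e' ∈ f.support.erase e, q ^ n := by
          rw [Finset.sum_mul]
          refine Finset.sum_le_sum fun e' he' => ?_
          obtain ⟨hne, hmem⟩ := Finset.mem_erase.1 he'
          obtain ⟨k, hk⟩ := not_forall.1 (hgood e' hmem hne)
          exact card_dotProd_modEq_mul_le hq e e' k hk
      _ ≤ (T - 1) * q ^ n := by
          rw [Finset.sum_const, smul_eq_mul, Finset.card_erase_of_mem he]
          gcongr
  have hqpos : (0 : ℝ) < q := by exact_mod_cast hq.pos
  rw [le_div_iff₀ (by norm_num)]
  refine le_of_mul_le_mul_right ?_ hqpos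
  have hnat := (Nat.mul_le_mul_left 32 hcount).trans
    ((Nat.mul_assoc 32 (T - 1) (q ^ n)).ge.trans (Nat.mul_le_mul_right (q ^ n) hbig))
  have hreal : (32 : ℝ) * (((Finset.univ.filter (fun v : Fin n → Fin q =>
      Collides f q (fun k => (v k : ℕ)) e)).card : ℝ) * q) ≤ q * (q : ℝ) ^ n := by
    exact_mod_cast hnat
  linarith

/-- Over a uniformly random prime `p i` followed by a uniformly random vector modulo `p i`, a
fixed term of `f` collides with probability at most `1/16`. -/
lemma sum_filter_collides_le {R : Type*} [CommRing R] {n : ℕ} (f : MvPolynomial (Fin n) R)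
    {T D N : ℕ} (hT : f.support.card ≤ T) (hD : f.totalDegree ≤ D) (hNpos : 0 < N)
    (hN : 31 * (((T : ℝ) - 1) * Real.logb 2 D) ≤ N)
    (p : Fin N → ℕ) (hprime : ∀ i, (p i).Prime) (hdist : Function.Injective p)
    (hbig : ∀ i, 32 * (T - 1) ≤ p i) {e : Fin n →₀ ℕ} (he : e ∈ f.support) :
    ∑ x ∈ Finset.univ.filter (fun x : Σ i : Fin N, (Fin n → Fin (p i)) =>
        Collides f (p x.1) (fun k => (x.2 k : ℕ)) e),
      (1 : ℝ) / ((N : ℝ) * (p x.1 : ℝ) ^ n) ≤ 1 / 16 := by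
  have hNr : (0 : ℝ) < N := by exact_mod_cast hNpos
  have hle : ∀ e ∈ f.support, ∀ k, e k ≤ D := fun e he k => by
    refine le_trans ?_ ((MvPolynomial.le_totalDegree he).trans hD)
    rw [Finsupp.sum_fintype _ _ fun _ => rfl]
    exact Finset.single_le_sum (fun i _ => Nat.zero_le (e i)) (Finset.mem_univ k)
  have hlog : 0 ≤ Real.logb 2 (D : ℝ) := by
    rcases Nat.eq_zero_or_pos D with h | h
    · simp [h]
    · exact Real.logb_nonneg one_lt_two (by exact_mod_cast h)
  let bad : Fin N → Prop := fun i => ∃ e' ∈ f.support, e' ≠ e ∧ ∀ k, e k ≡ e' k [MOD p i]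
  have hbad : 31 * ((Finset.univ.filter bad).card : ℝ) ≤ N := by
    have hsub : Finset.univ.filter bad ⊆ (f.support.erase e).biUnion fun e' =>
        Finset.univ.filter (fun i => ∀ k, e k ≡ e' k [MOD p i]) := by
      intro i hi
      obtain ⟨e', he', hne, h⟩ := (Finset.mem_filter.1 hi).2
      exact Finset.mem_biUnion.2
        ⟨e', Finset.mem_erase.2 ⟨hne, he'⟩, Finset.mem_filter.2 ⟨Finset.mem_univ _, h⟩⟩
    have hcard : ((Finset.univ.filter bad).card : ℝ) ≤ ((T : ℝ) - 1) * Real.logb 2 D := by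
      calc ((Finset.univ.filter bad).card : ℝ)
          ≤ ∑ e' ∈ f.support.erase e,
            ((Finset.univ.filter (fun i => ∀ k, e k ≡ e' k [MOD p i])).card : ℝ) := by
            exact_mod_cast (Finset.card_le_card hsub).trans Finset.card_biUnion_le
        _ ≤ ∑ _e' ∈ f.support.erase e, Real.logb 2 D := Finset.sum_le_sum fun e' he' =>
            card_filter_forall_modEq_le_logb p hprime hdist (Finset.mem_erase.1 he').1
              (hle e he) (hle e' (Finset.mem_erase.1 he').2)
        _ ≤ ((T : ℝ) - 1) * Real.logb 2 D := by
            rw [Finset.sum_const, nsmul_eq_mul, Finset.cast_card_erase_of_mem he]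
            have : (f.support.card : ℝ) ≤ T := by exact_mod_cast hT
            gcongr
    linarith
  have hfiber : ∀ i, ∑ v : Fin n → Fin (p i),
      (if Collides f (p i) (fun k => (v k : ℕ)) e then (1 : ℝ) / ((N : ℝ) * (p i : ℝ) ^ n) else 0)
      ≤ (1 / 32 + if bad i then 31 / 32 else 0) / N := by
    intro i
    have hpos : (0 : ℝ) < (p i : ℝ) ^ n := pow_pos (by exact_mod_cast (hprime i).pos) n
    rw [← Finset.sum_filter, Finset.sum_const, nsmul_eq_mul, mul_one_div, mul_comm (N : ℝ),
      ← div_div]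
    gcongr
    rw [div_le_iff₀ hpos]
    split_ifs with h
    · have : ((Finset.univ.filter (fun v : Fin n → Fin (p i) =>
          Collides f (p i) (fun k => (v k : ℕ)) e)).card : ℝ) ≤ (p i : ℝ) ^ n := by
        have := Finset.card_le_univ (Finset.univ.filter (fun v : Fin n → Fin (p i) =>
          Collides f (p i) (fun k => (v k : ℕ)) e))
        rw [Fintype.card_fun, Fintype.card_fin, Fintype.card_fin] at this
        exact_mod_cast this
      linarith
    · have := card_filter_collides_le f hT (hprime i) (hbig i) he
        fun e' he' hne hall => h ⟨e', he', hne, hall⟩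
      linarith
  rw [Finset.sum_filter, Fintype.sum_sigma]
  refine (Finset.sum_le_sum fun i _ => hfiber i).trans ?_
  rw [← Finset.sum_div, div_le_iff₀ hNr, Finset.sum_add_distrib, ← Finset.sum_filter]
  simp only [Finset.sum_const, nsmul_eq_mul, Finset.card_univ, Fintype.card_fin]
  linarith

/-- With probability at least `1 - μ` over `l` independent choices of a uniformly
random prime `p_{α_i}` among `p_1, …, p_N` followed by a uniformly random
`s_i ∈ Z_{p_{α_i}}^n`, every term of `f` collides in at most `(3/16)·l` of the `l`
reduced polynomials `f^mod_(p_{α_i})(x^{s_i})`.  Each outcome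
`ω : Fin l → Σ i, (Fin n → Fin (p i))` has probability `∏_j 1/(N · (p (ω j).1)^n)`. -/
theorem few_collisions_whp {R : Type*} [CommRing R] {n : ℕ}
    (f : MvPolynomial (Fin n) R) (hf : f ≠ 0)
    (T D : ℕ) (hT : f.support.card ≤ T) (hD : f.totalDegree ≤ D)
    (N : ℕ) (hN : N = max (31 * ⌈((T : ℝ) - 1) * Real.logb 2 D⌉₊) 1)
    (p : Fin N → ℕ) (hprime : ∀ i, (p i).Prime)
    (hdist : Function.Injective p)
    (hbig : ∀ i, 32 * (T - 1) ≤ p i)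
    (μ : ℝ) (hμ0 : 0 < μ) (hμ1 : μ < 1)
    (l : ℕ) (hl : ⌈(32 : ℝ) * Real.log ((T : ℝ) * μ⁻¹)⌉₊ ≤ l) :
    1 - μ ≤
      ∑ ω ∈ (Finset.univ.filter
        (fun ω : Fin l → Σ i : Fin N, (Fin n → Fin (p i)) =>
          ∀ e ∈ f.support,
            ((Finset.univ.filter (fun j : Fin l =>
                Collides f (p (ω j).1) (fun k => ((ω j).2 k : ℕ)) e)).card : ℝ) ≤
              (3 / 16 : ℝ) * (l : ℝ))),
        ∏ j : Fin l, (1 : ℝ) / ((N : ℝ) * (p (ω j).1 : ℝ) ^ n) := by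
  have hcard : 0 < f.support.card :=
    Finset.card_pos.2 (MvPolynomial.support_nonempty.2 hf)
  have hNpos : 0 < N := by rw [hN]; exact lt_of_lt_of_le one_pos (le_max_right _ _)
  have hNr : (0 : ℝ) < N := by exact_mod_cast hNpos
  have hNlog : 31 * (((T : ℝ) - 1) * Real.logb 2 D) ≤ N := by
    have h1 : 31 * ⌈((T : ℝ) - 1) * Real.logb 2 D⌉₊ ≤ N := hN ▸ le_max_left _ _
    have h2 : (31 : ℝ) * (⌈((T : ℝ) - 1) * Real.logb 2 D⌉₊ : ℝ) ≤ N := by exact_mod_cast h1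
    linarith [Nat.le_ceil (((T : ℝ) - 1) * Real.logb 2 D)]
  have hw1 : ∑ x : Σ i : Fin N, (Fin n → Fin (p i)), (1 : ℝ) / ((N : ℝ) * (p x.1 : ℝ) ^ n) = 1 := by
    rw [Fintype.sum_sigma]
    have hfiber : ∀ i : Fin N, ∑ _v : Fin n → Fin (p i), (1 : ℝ) / ((N : ℝ) * (p i : ℝ) ^ n) =
        1 / N := fun i => by
      have hp : (p i : ℝ) ≠ 0 := by exact_mod_cast (hprime i).ne_zero
      rw [Finset.sum_const, Finset.card_univ, Fintype.card_fun, Fintype.card_fin,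
        Fintype.card_fin, nsmul_eq_mul]
      push_cast
      field_simp
    simp only [hfiber, Finset.sum_const, Finset.card_univ, Fintype.card_fin, nsmul_eq_mul]
    field_simp
  have hmain := one_sub_le_sum_prod_filter
    (fun x : Σ i : Fin N, (Fin n → Fin (p i)) => (1 : ℝ) / ((N : ℝ) * (p x.1 : ℝ) ^ n))
    (fun x => by positivity) hw1 f.support
    (fun x e => Collides f (p x.1) (fun k => (x.2 k : ℕ)) e)
    (fun e he => sum_filter_collides_le f hT hD hNpos hNlog p hprime hdist hbig he) l
  refine le_trans ?_ hmain
  have hTpos : (0 : ℝ) < T := by exact_mod_cast hcard.trans_le hT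
  have hl' : 32 * Real.log ((T : ℝ) * μ⁻¹) ≤ l := Nat.ceil_le.1 hl
  have hexp : Real.exp (-(l : ℝ) / 32) ≤ μ / T := by
    rw [← Real.le_log_iff_exp_le (by positivity)]
    have : Real.log (μ / T) = -Real.log ((T : ℝ) * μ⁻¹) := by
      rw [← Real.log_inv, mul_inv, inv_inv, mul_comm, div_eq_mul_inv]
    linarith
  have : (f.support.card : ℝ) * Real.exp (-(l : ℝ) / 32) ≤ T * (μ / T) := by
    gcongr
  rw [mul_div_cancel₀ _ hTpos.ne'] at this
  linarith

end
end
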